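/- arXiv:math/0505243 — 3 statements merged into one kernel-verified Lean document; each statement's English description precedes it below -/
import Mathlib

section
/- Let U: ℝ → ℝ be concave and nondecreasing with U(0) = 0, and suppose there exist x̃ > 0 and 0 < γ < 1 such that U(λx) ≤ λ^γ U(x) for all x ≥ x̃ and all λ ≥ 1. Then there is a constant C > 0 such that for all x ∈ ℝ and all λ ≥ 1, both U(λx) ≤ λ U(x) + C λ^γ and U(λx) ≤ λ^γ U(x) + C λ^γ hold. -/
/-- A concave function on `ℝ` vanishing at `0` is subhomogeneous under dilations. -/
lemma ConcaveOn.map_mul_le_mul_of_one_le {U : ℝ → ℝ} (hU : ConcaveOn ℝ Set.univ U)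
    (hU0 : U 0 = 0) (x : ℝ) {lam : ℝ} (hlam : 1 ≤ lam) : U (lam * x) ≤ lam * U x := by
  have hpos : 0 < lam := by linarith
  have h := hU.2 (Set.mem_univ (lam * x)) (Set.mem_univ 0) (inv_nonneg.2 hpos.le)
    (sub_nonneg.2 (inv_le_one_of_one_le₀ hlam)) (by ring)
  simp only [smul_eq_mul, hU0, mul_zero, add_zero, inv_mul_cancel_left₀ hpos.ne'] at h
  exact (inv_mul_le_iff₀ hpos).1 h

/-- **Proposition 5.1.** If `U : ℝ → ℝ` is concave, nondecreasing, `U(0) = 0`, and there are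
`x̃ > 0` and `0 < γ < 1` with `U(λx) ≤ λ^γ U(x)` for all `x ≥ x̃` and `λ ≥ 1`, then there is a
constant `C > 0` such that for all `x ∈ ℝ` and `λ ≥ 1`, both `U(λx) ≤ λ U(x) + C λ^γ` and
`U(λx) ≤ λ^γ U(x) + C λ^γ`. -/
theorem asymptotic_elasticity_global
    (U : ℝ → ℝ) (hUconc : ConcaveOn ℝ Set.univ U) (hUmono : Monotone U)
    (hU0 : U 0 = 0) (xtil γ : ℝ) (hxtil : 0 < xtil) (hγ : γ ∈ Set.Ioo (0 : ℝ) 1)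
    (hAE : ∀ x ≥ xtil, ∀ lam ≥ (1 : ℝ), U (lam * x) ≤ lam ^ γ * U x) :
    ∃ C > (0 : ℝ), ∀ x : ℝ, ∀ lam ≥ (1 : ℝ),
      U (lam * x) ≤ lam * U x + C * lam ^ γ ∧
      U (lam * x) ≤ lam ^ γ * U x + C * lam ^ γ := by
  have hC : 0 ≤ U xtil := hU0 ▸ hUmono hxtil.le
  refine ⟨U xtil + 1, by linarith, fun x lam hlam => ?_⟩
  have hp : 0 < lam ^ γ := Real.rpow_pos_of_pos (by linarith) γ
  have hCp : 0 ≤ (U xtil + 1) * lam ^ γ := by positivity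
  have hlin := hUconc.map_mul_le_mul_of_one_le hU0 x hlam
  refine ⟨by linarith, ?_⟩
  rcases le_total x 0 with hx | hx
  · have hUx : U x ≤ 0 := hU0 ▸ hUmono hx
    have hle : lam ^ γ ≤ lam := Real.rpow_le_self_of_one_le hlam hγ.2.le
    have := mul_le_mul_of_nonpos_right hle hUx
    linarith
  · rcases le_total xtil x with hxx | hxx
    · linarith [hAE x hxx lam hlam]
    · have hUx : 0 ≤ U x := hU0 ▸ hUmono hx
      have h1 : U (lam * x) ≤ U (lam * xtil) :=
        hUmono (mul_le_mul_of_nonneg_left hxx (by linarith))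
      have h2 := hAE xtil le_rfl lam hlam
      have h3 := mul_nonneg hp.le hUx
      linarith
end

section
/- Let f: ℝ^d → ℝ be a concave function. Then for all s, s' ∈ ℝ^d with 0 < |s − s'| ≤ 1, |f(s) − f(s')| ≤ |s − s'| · max( |f(s) − f(s + (s' − s)/|s − s'|)| , |f(s') − f(s' + (s − s')/|s − s'|)| ). -/
open scoped RealInnerProductSpace

/-- A concave function decreases from `x` to `y` by at most the fraction `r` of its decrease from
`x` to the point `x + r⁻¹ • (y - x)` further along the same ray. -/
theorem ConcaveOn.sub_le_mul_sub_add_inv_smul {E : Type*} [AddCommGroup E] [Module ℝ E]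
    {f : E → ℝ} (hf : ConcaveOn ℝ Set.univ f) (x y : E) {r : ℝ} (h0 : 0 < r) (h1 : r ≤ 1) :
    f x - f y ≤ r * (f x - f (x + r⁻¹ • (y - x))) := by
  have h := hf.2 (Set.mem_univ x) (Set.mem_univ (x + r⁻¹ • (y - x)))
    (sub_nonneg.2 h1) h0.le (sub_add_cancel 1 r)
  have hy : (1 - r) • x + r • (x + r⁻¹ • (y - x)) = y := by
    rw [smul_add, smul_inv_smul₀ h0.ne']
    module
  rw [hy, smul_eq_mul, smul_eq_mul] at h
  linarith

/-- **Proposition 6.3.** For a concave `f : ℝ^d → ℝ` and `s, s'` with `0 < ‖s − s'‖ ≤ 1`,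
`|f(s) − f(s')| ≤ ‖s − s'‖ · max(|f(s) − f(s + (s'−s)/‖s−s'‖)|, |f(s') − f(s' + (s−s')/‖s−s'‖)|)`. -/
theorem concave_increment_bound {d : ℕ}
    (f : EuclideanSpace ℝ (Fin d) → ℝ) (hf : ConcaveOn ℝ Set.univ f)
    (s s' : EuclideanSpace ℝ (Fin d)) (h0 : 0 < ‖s - s'‖) (h1 : ‖s - s'‖ ≤ 1) :
    |f s - f s'| ≤ ‖s - s'‖ *
      max |f s - f (s + ‖s - s'‖⁻¹ • (s' - s))|
        |f s' - f (s' + ‖s - s'‖⁻¹ • (s - s'))| := by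
  refine abs_sub_le_iff.2 ⟨?_, ?_⟩
  · exact (hf.sub_le_mul_sub_add_inv_smul s s' h0 h1).trans
      (mul_le_mul_of_nonneg_left ((le_abs_self _).trans (le_max_left _ _)) h0.le)
  · exact (hf.sub_le_mul_sub_add_inv_smul s' s h0 h1).trans
      (mul_le_mul_of_nonneg_left ((le_abs_self _).trans (le_max_right _ _)) h0.le)
end

section
/- Let η_n: ℝ × Ω → ℝ^d be a sequence of B(ℝ) ⊗ H-measurable functions such that for almost all ω, liminf_{n→∞} |η_n(x, ω)| < ∞ for all x ∈ ℝ. Then there exists a sequence (n_k) of B(ℝ) ⊗ H-measurable ℕ-valued functions with n_k(x, ω) < n_{k+1}(x, ω) for all k, such that almost surely, for all x ∈ ℝ, η̃_k(x, ω) := η_{n_k(x,ω)}(x, ω) converges as k → ∞ to some limit η̃(x, ω); i.e. there is a convergent random subsequence. -/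
open MeasureTheory Filter Topology
open scoped ENNReal

namespace RandomSubsequence

/-- The indices satisfying `S` and the first `Q j` that holds frequently on `S`. -/
def refine (S : ℕ → Prop) (Q : ℕ → ℕ → Prop) (n : ℕ) : Prop :=
  ∃ j, (S n ∧ Q j n) ∧ (∃ᶠ m in atTop, S m ∧ Q j m) ∧
    ∀ i < j, ¬ ∃ᶠ m in atTop, S m ∧ Q i m

/-- Successive refinements by the families `Q 0`, `Q 1`, …. -/
def iterRefine (Q : ℕ → ℕ → ℕ → Prop) : ℕ → ℕ → Prop
  | 0 => refine (fun _ => True) (Q 0)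
  | k + 1 => refine (iterRefine Q k) (Q (k + 1))

lemma refine_subset {S : ℕ → Prop} {Q : ℕ → ℕ → Prop} {n : ℕ} (h : refine S Q n) : S n := by
  obtain ⟨j, h, -⟩ := h
  exact h.1

lemma exists_forall_of_refine (S : ℕ → Prop) (Q : ℕ → ℕ → Prop) :
    ∃ j, ∀ n, refine S Q n → Q j n := by
  by_cases h : ∃ n, refine S Q n
  · obtain ⟨-, j, -, hj, hjmin⟩ := h
    refine ⟨j, ?_⟩
    rintro n ⟨i, hn, hi, himin⟩
    obtain hlt | rfl | hlt := lt_trichotomy i j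
    · exact absurd hi (hjmin i hlt)
    · exact hn.2
    · exact absurd hj (himin j hlt)
  · push Not at h
    exact ⟨0, fun n hn => absurd hn (h n)⟩

lemma frequently_refine {S : ℕ → Prop} {Q : ℕ → ℕ → Prop}
    (h : ∃ j, ∃ᶠ m in atTop, S m ∧ Q j m) : ∃ᶠ n in atTop, refine S Q n := by
  classical
  exact (Nat.find_spec h).mono fun n hn =>
    ⟨Nat.find h, hn, Nat.find_spec h, fun i hi => Nat.find_min h hi⟩

lemma iterRefine_antitone (Q : ℕ → ℕ → ℕ → Prop) : Antitone (iterRefine Q) :=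
  antitone_nat_of_succ_le fun _ _ => refine_subset

section Measurability

variable {α : Type*} [MeasurableSpace α]

lemma measurableSet_frequently {p : α → ℕ → Prop} (hp : ∀ n, MeasurableSet {a | p a n}) :
    MeasurableSet {a | ∃ᶠ n in atTop, p a n} := by
  simp only [frequently_atTop, Set.ofPred_forall, Set.ofPred_exists, Set.ofPred_and]
  exact .iInter fun N => .iUnion fun n => (MeasurableSet.const _).inter (hp n)

lemma measurableSet_refine {S : α → ℕ → Prop} {Q : α → ℕ → ℕ → Prop}
    (hS : ∀ n, MeasurableSet {a | S a n}) (hQ : ∀ j n, MeasurableSet {a | Q a j n}) (n : ℕ) :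
    MeasurableSet {a | refine (S a) (Q a) n} := by
  have hSQ : ∀ j n, MeasurableSet {a | S a n ∧ Q a j n} := fun j n => (hS n).inter (hQ j n)
  have hfreq : ∀ j, MeasurableSet {a | ∃ᶠ m in atTop, S a m ∧ Q a j m} := fun j =>
    measurableSet_frequently (hSQ j)
  simp only [refine, Set.ofPred_exists, Set.ofPred_and (p := fun a => S a n ∧ _),
    Set.ofPred_and (p := fun a => ∃ᶠ m in atTop, _), Set.ofPred_forall]
  exact .iUnion fun j => (hSQ j n).inter <| (hfreq j).inter <|
    .iInter fun i => .iInter fun _ => (hfreq i).compl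

lemma measurableSet_iterRefine {Q : α → ℕ → ℕ → ℕ → Prop}
    (hQ : ∀ k j n, MeasurableSet {a | Q a k j n}) (k n : ℕ) :
    MeasurableSet {a | iterRefine (Q a) k n} := by
  induction k generalizing n with
  | zero => exact measurableSet_refine (fun _ => .const _) (hQ 0) n
  | succ k ih => exact measurableSet_refine ih (hQ (k + 1)) n

lemma exists_measurable_next {S : α → ℕ → Prop} (hS : ∀ n, MeasurableSet {a | S a n})
    {g : α → ℕ} (hg : Measurable g) :
    ∃ g' : α → ℕ, Measurable g' ∧ (∀ a, g a < g' a) ∧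
      ∀ a, (∃ᶠ n in atTop, S a n) → S a (g' a) := by
  classical
  have hex : ∀ a, ∃ n, g a < n ∧ (S a n ∨ ¬ ∃ᶠ n in atTop, S a n) := by
    intro a
    by_cases h : ∃ᶠ n in atTop, S a n
    · obtain ⟨n, hn, hSn⟩ := frequently_atTop.1 h (g a + 1)
      exact ⟨n, hn, .inl hSn⟩
    · exact ⟨g a + 1, Nat.lt_succ_self _, .inr h⟩
  refine ⟨fun a => Nat.find (hex a), measurable_find hex fun n => ?_,
    fun a => (Nat.find_spec (hex a)).1,
    fun a ha => (Nat.find_spec (hex a)).2.resolve_right (not_not_intro ha)⟩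
  exact (measurableSet_lt hg measurable_const).inter
    ((hS n).union (measurableSet_frequently hS).compl)

lemma exists_measurable_diagonal {S : ℕ → α → ℕ → Prop}
    (hS : ∀ k n, MeasurableSet {a | S k a n}) :
    ∃ g : ℕ → α → ℕ, (∀ k, Measurable (g k)) ∧ (∀ k a, g k a < g (k + 1) a) ∧
      ∀ a, (∀ k, ∃ᶠ n in atTop, S k a n) → ∀ k, S k a (g k a) := by
  choose next hmeas hlt hmem using fun (k : ℕ) (g : {g : α → ℕ // Measurable g}) =>
    exists_measurable_next (hS k) g.2
  let G : ℕ → {g : α → ℕ // Measurable g} := fun k =>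
    Nat.rec ⟨next 0 ⟨fun _ => 0, measurable_const⟩, hmeas _ _⟩
      (fun k g => ⟨next (k + 1) g, hmeas _ _⟩) k
  refine ⟨fun k => (G k).1, fun k => (G k).2, fun k a => hlt (k + 1) (G k) a, fun a ha k => ?_⟩
  cases k with
  | zero => exact hmem 0 _ a (ha 0)
  | succ k => exact hmem (k + 1) (G k) a (ha (k + 1))

end Measurability

variable {E : Type*} [NormedAddCommGroup E] [ProperSpace E]

/-- At level `0`, the norm is at most `j`; at level `k + 1`, the distance to the `j`-th point of a
dense sequence is less than `1 / (k + 1)`. -/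
def cell (u : ℕ → E) : ℕ → ℕ → ℕ → Prop
  | 0, j, n => ‖u n‖ ≤ j
  | k + 1, j, n => dist (u n) (TopologicalSpace.denseSeq E j) < 1 / ((k : ℝ) + 1)

lemma frequently_iterRefine_cell {u : ℕ → E} {M : ℕ} (hM : ∃ᶠ n in atTop, ‖u n‖ ≤ M) (k : ℕ) :
    ∃ᶠ n in atTop, iterRefine (cell u) k n := by
  induction k with
  | zero => exact frequently_refine ⟨M, by simpa [cell] using hM⟩
  | succ k ih =>
    apply frequently_refine
    obtain ⟨R, hR⟩ := exists_forall_of_refine (fun _ => True) (cell u 0)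
    have hbdd : ∀ n, iterRefine (cell u) k n → u n ∈ Metric.closedBall (0 : E) R := fun n hn =>
      mem_closedBall_zero_iff.2 (hR n (iterRefine_antitone (cell u) (Nat.zero_le k) n hn))
    have : (atTop ⊓ 𝓟 {n | iterRefine (cell u) k n}).NeBot := frequently_mem_iff_neBot.1 ih
    obtain ⟨y, -, hy⟩ := (isCompact_closedBall (0 : E) R).exists_mapClusterPt
      (f := atTop ⊓ 𝓟 {n | iterRefine (cell u) k n}) (u := u)
      (by
        rw [le_principal_iff, mem_map]
        exact mem_inf_of_right hbdd)
    obtain ⟨j, hj⟩ := (TopologicalSpace.denseRange_denseSeq E).exists_dist_lt y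
      (Nat.one_div_pos_of_nat (α := ℝ) (n := k))
    refine ⟨j, ?_⟩
    have hfreq := hy.frequently (Metric.isOpen_ball.mem_nhds (Metric.mem_ball.2 hj))
    rw [frequently_inf_principal] at hfreq
    exact hfreq

/-- A diagonal sequence through the successive refinements converges. -/
lemma exists_tendsto_of_iterRefine_cell {u : ℕ → E} {g : ℕ → ℕ}
    (hg : ∀ k, iterRefine (cell u) k (g k)) : ∃ y, Tendsto (u ∘ g) atTop (𝓝 y) := by
  apply cauchySeq_tendsto_of_complete
  rw [Metric.cauchySeq_iff]
  intro ε hε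
  obtain ⟨k, hk⟩ := exists_nat_one_div_lt (half_pos hε)
  obtain ⟨j, hj⟩ := exists_forall_of_refine (iterRefine (cell u) k) (cell u (k + 1))
  have hclose : ∀ m ≥ k + 1, dist (u (g m)) (TopologicalSpace.denseSeq E j) < ε / 2 := fun m hm =>
    lt_trans (hj (g m) (iterRefine_antitone (cell u) hm _ (hg m))) hk
  refine ⟨k + 1, fun m hm n hn => ?_⟩
  have := dist_triangle_right (u (g m)) (u (g n)) (TopologicalSpace.denseSeq E j)
  simp only [Function.comp_apply]
  linarith [hclose m hm, hclose n hn]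

lemma measurableSet_cell {α : Type*} [MeasurableSpace α] [MeasurableSpace E] [BorelSpace E]
    {f : ℕ → α → E} (hf : ∀ n, Measurable (f n)) (k j n : ℕ) :
    MeasurableSet {a | cell (fun m => f m a) k j n} := by
  cases k with
  | zero => exact measurableSet_le (hf n).norm measurable_const
  | succ k => exact measurableSet_lt ((hf n).dist measurable_const) measurable_const

/-- Measurable selection of a convergent subsequence at all points where the sequence does not
tend to infinity in norm. -/
theorem exists_measurable_subsequence {α : Type*} [MeasurableSpace α] [MeasurableSpace E]
    [BorelSpace E] {f : ℕ → α → E} (hf : ∀ n, Measurable (f n)) :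
    ∃ g : ℕ → α → ℕ, (∀ k, Measurable (g k)) ∧ (∀ k a, g k a < g (k + 1) a) ∧
      ∀ a, liminf (fun n => (‖f n a‖₊ : ℝ≥0∞)) atTop < ⊤ →
        ∃ y, Tendsto (fun k => f (g k a) a) atTop (𝓝 y) := by
  obtain ⟨g, hmeas, hlt, hmem⟩ := exists_measurable_diagonal
    (S := fun k a => iterRefine (cell fun m => f m a) k)
    (measurableSet_iterRefine (measurableSet_cell hf))
  refine ⟨g, hmeas, hlt, fun a ha => ?_⟩
  obtain ⟨M, hM⟩ := ENNReal.exists_nat_gt ha.ne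
  have hfreq : ∃ᶠ n in atTop, ‖f n a‖ ≤ M :=
    (frequently_lt_of_liminf_lt (by isBoundedDefault) hM).mono fun n hn => by
      exact_mod_cast hn.le
  exact exists_tendsto_of_iterRefine_cell (hmem a (frequently_iterRefine_cell hfreq))

end RandomSubsequence

/-- **Lemma A.2.** If `η_n : ℝ × Ω → ℝ^d` are `B(ℝ) ⊗ H`-measurable and for almost all `ω`,
`liminf_n |η_n(x,ω)| < ∞` for all `x`, then there is a random subsequence, given by
`B(ℝ) ⊗ H`-measurable index functions `n_k` strictly increasing in `k`, along which `η`
converges almost surely for every `x` to some limit `η̃(x,ω)`. -/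
theorem random_subsequence_convergence
    {Ω : Type*} [mΩ : MeasurableSpace Ω]
    (P : Measure Ω) [IsProbabilityMeasure P]
    (H : MeasurableSpace Ω) (hH : H ≤ mΩ)
    (hHnull : ∀ s : Set Ω, MeasurableSet s → P s = 0 → MeasurableSet[H] s)
    (d : ℕ) (η : ℕ → ℝ → Ω → EuclideanSpace ℝ (Fin d))
    (hηmeas : ∀ n, Measurable[MeasurableSpace.prod inferInstance H]
      (Function.uncurry (η n)))
    (hbdd : ∀ᵐ ω ∂P, ∀ x : ℝ,
      Filter.atTop.liminf (fun n => (‖η n x ω‖₊ : ℝ≥0∞)) < ⊤) :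
    ∃ nk : ℕ → ℝ → Ω → ℕ,
      (∀ k, Measurable[MeasurableSpace.prod inferInstance H]
        (Function.uncurry (nk k))) ∧
      (∀ k x ω, nk k x ω < nk (k + 1) x ω) ∧
      ∃ ηtil : ℝ → Ω → EuclideanSpace ℝ (Fin d),
        ∀ᵐ ω ∂P, ∀ x : ℝ,
          Tendsto (fun k => η (nk k x ω) x ω) atTop (𝓝 (ηtil x ω)) := by
  let _ : MeasurableSpace (ℝ × Ω) := MeasurableSpace.prod inferInstance H
  obtain ⟨g, hmeas, hlt, hconv⟩ := RandomSubsequence.exists_measurable_subsequence hηmeas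
  have hlim : ∀ x ω, ∃ y, liminf (fun n => (‖η n x ω‖₊ : ℝ≥0∞)) atTop < ⊤ →
      Tendsto (fun k => η (g k (x, ω)) x ω) atTop (𝓝 y) := fun x ω => by
    by_cases h : liminf (fun n => (‖η n x ω‖₊ : ℝ≥0∞)) atTop < ⊤
    · obtain ⟨y, hy⟩ := hconv (x, ω) h
      exact ⟨y, fun _ => hy⟩
    · exact ⟨0, fun h' => absurd h' h⟩
  choose ηtil hηtil using hlim
  exact ⟨fun k x ω => g k (x, ω), hmeas, fun k x ω => hlt k (x, ω), ηtil,
    hbdd.mono fun ω hω x => hηtil x ω (hω x)⟩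
end
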